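/- Let d ≥ 3 and let F ≤ Sym({1,…,d}) be primitive but not cyclic of prime order. Then for every end ξ ∈ ∂𝒯, the pair (U(F)⁺, (U(F)⁺)_ξ⁰) has the relative Howe–Moore property, where (U(F)⁺)_ξ⁰ = {g ∈ U(F)⁺ : g(ξ) = ξ and g fixes some vertex of 𝒯} is a closed subgroup of U(F)⁺. -/

import Mathlib

open Filter Topology
open scoped InnerProductSpace

namespace TreeHM

variable {V : Type}

/-! ### The automorphism group of a graph, with the topology of pointwise convergence -/

noncomputable instance autTopologicalSpace (T : SimpleGraph V) : TopologicalSpace (T ≃g T) :=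
  letI : TopologicalSpace V := ⊥
  TopologicalSpace.induced (fun (g : T ≃g T) (x : V) => g x) inferInstance

/-- A graph automorphism preserves the combinatorial distance. -/
theorem iso_dist_le (T : SimpleGraph V) (g : T ≃g T) (u v : V) :
    T.dist (g u) (g v) ≤ T.dist u v := by
  by_cases h : T.Reachable u v
  · obtain ⟨p, hp⟩ := h.exists_walk_length_eq_dist
    calc T.dist (g u) (g v) ≤ (p.map g.toHom).length := SimpleGraph.dist_le _
      _ = p.length := SimpleGraph.Walk.length_map _ _
      _ = T.dist u v := hp
  · rw [SimpleGraph.dist_eq_zero_of_not_reachable h,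
      SimpleGraph.dist_eq_zero_of_not_reachable]
    intro hr
    have := hr.map g.symm.toHom
    exact h (by simpa using this)

theorem iso_dist_eq (T : SimpleGraph V) (g : T ≃g T) (u v : V) :
    T.dist (g u) (g v) = T.dist u v := by
  refine le_antisymm (iso_dist_le T g u v) ?_
  have := iso_dist_le T g⁻¹ (g u) (g v)
  simpa using this

/-- The tree `T` is locally finite. -/
def LocFin (T : SimpleGraph V) : Prop := ∀ x : V, (T.neighborSet x).Finite

/-- The graph `T` is `d`-regular: every vertex has exactly `d` neighbours. -/
def Regular (T : SimpleGraph V) (d : ℕ) : Prop := ∀ x : V, (T.neighborSet x).ncard = d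

/-! ### Geodesic rays and ends -/

/-- A geodesic ray in a graph; for a tree, the ends `∂T` are the equivalence classes of
geodesic rays under the relation `RayEquiv` of sharing a common subray.  Throughout, an end
`ξ ∈ ∂T` is represented by a geodesic ray, and equality of ends is `RayEquiv`. -/
structure GeodRay (T : SimpleGraph V) : Type where
  seq : ℕ → V
  adj : ∀ n, T.Adj (seq n) (seq (n + 1))
  geodesic : ∀ m n, T.dist (seq m) (seq n) = Nat.dist m n

/-- A bi-infinite geodesic line in a graph. -/
structure GeodLine (T : SimpleGraph V) : Type where
  seq : ℤ → V
  adj : ∀ n, T.Adj (seq n) (seq (n + 1))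
  geodesic : ∀ m n, T.dist (seq m) (seq n) = (m - n).natAbs

/-- Two geodesic rays are equivalent (define the same end) iff they share a common subray. -/
def RayEquiv (T : SimpleGraph V) (r s : GeodRay T) : Prop :=
  ∃ k l : ℕ, ∀ n : ℕ, r.seq (k + n) = s.seq (l + n)

/-- The image of a geodesic ray under an automorphism. -/
def mapRay (T : SimpleGraph V) (g : T ≃g T) (r : GeodRay T) : GeodRay T where
  seq := fun n => g (r.seq n)
  adj := fun n => g.map_adj_iff.mpr (r.adj n)
  geodesic := fun m n => by rw [iso_dist_eq]; exact r.geodesic m n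

/-- `g` fixes the end represented by the ray `r`. -/
def FixesEnd (T : SimpleGraph V) (g : T ≃g T) (r : GeodRay T) : Prop :=
  RayEquiv T (mapRay T g r) r

/-- A sequence of vertices converges to the end represented by the geodesic ray `r`:
for every `m`, the vertex `r.seq m` eventually lies on the geodesic from `r.seq 0` to `y n`,
i.e. the common initial segment of `[r.seq 0, y n]` and the ray tends to infinity. -/
def TendstoEnd (T : SimpleGraph V) (y : ℕ → V) (r : GeodRay T) : Prop :=
  ∀ m : ℕ, ∀ᶠ n in atTop, T.dist (r.seq 0) (y n) = m + T.dist (r.seq m) (y n)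

/-! ### Translation length and hyperbolic automorphisms -/

/-- The translation length `|g| = min_x dist(x, g x)` of an automorphism. -/
noncomputable def transLen (T : SimpleGraph V) (g : T ≃g T) : ℕ :=
  sInf (Set.range fun x : V => T.dist x (g x))

/-- `g` is hyperbolic iff its translation length is positive. -/
def IsHyperbolic (T : SimpleGraph V) (g : T ≃g T) : Prop := 0 < transLen T g

/-- The set `Min(g)` of vertices realizing the translation length; for a hyperbolic
automorphism of a tree this is its translation axis. -/
def MinSet (T : SimpleGraph V) (g : T ≃g T) : Set V :=
  {x : V | T.dist x (g x) = transLen T g}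

/-- The ray `r` (based at the axis) represents the attracting end of `a`:
the orbit `a^n x` converges to this end. -/
def IsAttractingEnd (T : SimpleGraph V) (a : T ≃g T) (r : GeodRay T) : Prop :=
  TendstoEnd T (fun n : ℕ => (a ^ n) (r.seq 0)) r

/-! ### Half-trees and Tits' independence property -/

/-- The half-tree determined by an oriented edge `(a, b)` of a tree:  all vertices `y`
lying on the side of `a`, i.e. whose geodesic to `b` passes through `a`. -/
def EdgeSide (T : SimpleGraph V) (a b : V) : Set V :=
  {y : V | T.dist b y = T.dist a y + 1}

/-- The half-tree emanating from the base vertex `r.seq 0` of a ray `r` and containing the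
end of `r` in its boundary. -/
def RaySide (T : SimpleGraph V) (r : GeodRay T) : Set V :=
  {y : V | y = r.seq 0 ∨ T.dist (r.seq 0) y = 1 + T.dist (r.seq 1) y}

/-- Tits' independence property for a subgroup `G ≤ Aut(T)`:  for every edge `e = (a, b)`,
the pointwise stabilizer `G_e` decomposes as `G_{T₁} · G_{T₂}`, where `T₁, T₂` are the two
half-trees emanating from `e` and `G_{Tᵢ}` is the pointwise stabilizer of `Tᵢ`. -/
def TitsIndep (T : SimpleGraph V) (G : Subgroup (T ≃g T)) : Prop :=
  ∀ a b : V, T.Adj a b → ∀ g ∈ G, g a = a → g b = b →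
    ∃ g₁ ∈ G, ∃ g₂ ∈ G, g = g₁ * g₂ ∧
      (∀ y ∈ EdgeSide T a b, g₁ y = y) ∧ (∀ y ∈ EdgeSide T b a, g₂ y = y)

/-! ### Stabilizers and contraction groups -/

/-- The subgroup `G_ξ⁰ = {g ∈ G : g ξ = ξ and g fixes some vertex}`, as a subset of `G`. -/
def EndStab0 (T : SimpleGraph V) (G : Subgroup (T ≃g T)) (ξ : GeodRay T) : Set G :=
  {g : G | FixesEnd T (g : T ≃g T) ξ ∧ ∃ x : V, (g : T ≃g T) x = x}

/-- The contraction group `U⁺_α` of a sequence `α` in `G`. -/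
def ContrSeq {G : Type} [Group G] [TopologicalSpace G] (α : ℕ → G) : Set G :=
  {g : G | Tendsto (fun n : ℕ => (α n)⁻¹ * g * α n) atTop (𝓝 1)}

/-- The contraction group `U⁺_a = {g : a⁻ⁿ g aⁿ → 1}` of an element `a` of `G`. -/
def Upos {G : Type} [Group G] [TopologicalSpace G] (a : G) : Set G :=
  ContrSeq (fun n : ℕ => a ^ n)

/-- The contraction group `U⁻_a = {g : aⁿ g a⁻ⁿ → 1}` of an element `a` of `G`. -/
def Uneg {G : Type} [Group G] [TopologicalSpace G] (a : G) : Set G :=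
  ContrSeq (fun n : ℕ => (a ^ n)⁻¹)

/-! ### Unitary representations and the Howe–Moore property -/

/-- A (strongly continuous) unitary representation of a topological group `G` on a complex
inner product space `H`. -/
structure UnitaryRep (G : Type) [Group G] [TopologicalSpace G]
    (H : Type) [NormedAddCommGroup H] [InnerProductSpace ℂ H] where
  ρ : G →* (H ≃ₗᵢ[ℂ] H)
  strong_continuity : ∀ v : H, Continuous fun g : G => ρ g v

/-- The representation `π` has no nonzero `G`-invariant vector. -/
def NoInvariantVectors {G : Type} [Group G] [TopologicalSpace G]
    {H : Type} [NormedAddCommGroup H] [InnerProductSpace ℂ H]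
    (π : UnitaryRep G H) : Prop :=
  ∀ v : H, (∀ g : G, π.ρ g v = v) → v = 0

/-- The Howe–Moore property: every unitary representation without nonzero invariant vectors
has all its matrix coefficients vanishing at infinity. -/
def HasHoweMoore (G : Type) [Group G] [TopologicalSpace G] : Prop :=
  ∀ (H : Type) [NormedAddCommGroup H] [InnerProductSpace ℂ H] [CompleteSpace H]
    (π : UnitaryRep G H), NoInvariantVectors π →
      ∀ v w : H, Tendsto (fun g : G => ⟪π.ρ g v, w⟫_ℂ) (cocompact G) (𝓝 0)

/-! ### Legal colorings and the universal groups of Burger–Mozes -/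

/-- A legal coloring of a `d`-regular tree: a coloring of the (unoriented) edges by
`{1, …, d}` whose restriction to the star of each vertex is a bijection onto `{1, …, d}`.
The color of the edge `{x, y}` is recorded as `color x y` with `color x y = color y x`. -/
structure LegalColoring (T : SimpleGraph V) (d : ℕ) where
  color : V → V → Fin d
  symm : ∀ x y : V, T.Adj x y → color x y = color y x
  injOn : ∀ x : V, Set.InjOn (color x) (T.neighborSet x)
  surjOn : ∀ x : V, Set.SurjOn (color x) (T.neighborSet x) Set.univ

/-- Membership in the universal group `U(F)`: at every vertex `x` the local action of `g`
on colors is given by an element of `F`. -/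
def InUF {d : ℕ} (T : SimpleGraph V) (F : Subgroup (Equiv.Perm (Fin d)))
    (ι : LegalColoring T d) (g : T ≃g T) : Prop :=
  ∀ x : V, ∃ σ ∈ F, ∀ y : V, T.Adj x y → σ (ι.color x y) = ι.color (g x) (g y)

/-- The universal group `U(F)⁺`: the subgroup of `Aut(T)` generated by the elements of
`U(F)` fixing (pointwise) an edge of `T`. -/
def UFplus {d : ℕ} (T : SimpleGraph V) (F : Subgroup (Equiv.Perm (Fin d)))
    (ι : LegalColoring T d) : Subgroup (T ≃g T) :=
  Subgroup.closure
    {g : T ≃g T | InUF T F ι g ∧ ∃ x y : V, T.Adj x y ∧ g x = x ∧ g y = y}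

/-! ### Permutation group conditions -/

/-- `F` acts transitively on `{1, …, d}`. -/
def PermTransitive {d : ℕ} (F : Subgroup (Equiv.Perm (Fin d))) : Prop :=
  ∀ i j : Fin d, ∃ σ ∈ F, σ i = j

/-- `F` acts 2-transitively on `{1, …, d}`. -/
def PermTwoTransitive {d : ℕ} (F : Subgroup (Equiv.Perm (Fin d))) : Prop :=
  ∀ a b c e : Fin d, a ≠ b → c ≠ e → ∃ σ ∈ F, σ a = c ∧ σ b = e

/-- `F` acts primitively on `{1, …, d}`: it is transitive and every block of the action
is trivial (a subsingleton or the whole set). -/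
def PermPrimitive {d : ℕ} (F : Subgroup (Equiv.Perm (Fin d))) : Prop :=
  PermTransitive F ∧
    ∀ B : Set (Fin d),
      (∀ σ ∈ F, (σ : Equiv.Perm (Fin d)) '' B = B ∨
        Disjoint ((σ : Equiv.Perm (Fin d)) '' B) B) →
      B.Subsingleton ∨ B = Set.univ

/-- `F` is a cyclic group of prime order. -/
def CyclicOfPrimeOrder {d : ℕ} (F : Subgroup (Equiv.Perm (Fin d))) : Prop :=
  IsCyclic F ∧ (Nat.card F).Prime

/-- `F` is generated by its point stabilizers `F_i = {σ ∈ F : σ i = i}`. -/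
def GenByPointStabilizers {d : ℕ} (F : Subgroup (Equiv.Perm (Fin d))) : Prop :=
  F = Subgroup.closure {σ : Equiv.Perm (Fin d) | σ ∈ F ∧ ∃ i : Fin d, σ i = i}



/-! ### Tree combinatorics -/

theorem closer_unique {T : SimpleGraph V} (hT : T.IsTree) {x y z s : V} (hy : T.Adj x y)
    (hz : T.Adj x z) (h1 : T.dist x s = T.dist y s + 1) (h2 : T.dist x s = T.dist z s + 1) :
    y = z := by
  obtain ⟨p, hp⟩ := hT.connected.exists_walk_length_eq_dist y s
  obtain ⟨q, hq⟩ := hT.connected.exists_walk_length_eq_dist z s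
  have hp' := (SimpleGraph.Walk.cons hy p).isPath_of_length_eq_dist (by simp [hp, h1])
  have hq' := (SimpleGraph.Walk.cons hz q).isPath_of_length_eq_dist (by simp [hq, h2])
  have := (hT.isAcyclic.subsingleton_path x s).elim ⟨_, hp'⟩ ⟨_, hq'⟩
  have h3 := congrArg (fun w : T.Path x s => w.1.snd) this
  simpa using h3

theorem side_or {T : SimpleGraph V} (hT : T.IsTree) {a b : V} (hab : T.Adj a b) (y : V) :
    y ∈ EdgeSide T a b ∨ y ∈ EdgeSide T b a := by
  have := hT.dist_eq_dist_add_one_of_adj y hab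
  simp only [EdgeSide, Set.mem_ofPred_eq, T.dist_comm (v := y)]
  tauto

theorem not_both {T : SimpleGraph V} {a b y : V} (h1 : y ∈ EdgeSide T a b)
    (h2 : y ∈ EdgeSide T b a) : False := by
  simp only [EdgeSide, Set.mem_ofPred_eq] at h1 h2
  omega

theorem exists_closer {T : SimpleGraph V} (hT : T.IsTree) {x s : V} (h : x ≠ s) :
    ∃ y, T.Adj x y ∧ T.dist x s = T.dist y s + 1 := by
  obtain ⟨p, hp⟩ := hT.connected.exists_walk_length_eq_dist x s
  cases p with
  | nil => exact absurd rfl h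
  | @cons _ y _ hy p =>
    refine ⟨y, hy, ?_⟩
    have h1 := SimpleGraph.dist_le p
    simp only [SimpleGraph.Walk.length_cons] at hp
    have := hT.dist_eq_dist_add_one_of_adj s hy
    rw [T.dist_comm (u := s), T.dist_comm (u := s)] at this
    omega

theorem cross {T : SimpleGraph V} (hT : T.IsTree) {a b u v : V} (hab : T.Adj a b)
    (hu : u ∈ EdgeSide T a b) (hv : v ∈ EdgeSide T b a) (huv : T.Adj u v) : u = a ∧ v = b := by
  simp only [EdgeSide, Set.mem_ofPred_eq] at hu hv
  have h1 := hT.dist_eq_dist_add_one_of_adj a huv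
  have h2 := hT.dist_eq_dist_add_one_of_adj b huv
  have hpq : T.dist a u = T.dist b v := by omega
  by_cases hvb : v = b
  · subst hvb
    refine ⟨?_, rfl⟩
    have : T.dist a u = 0 := by simpa using hpq
    exact (hT.connected.dist_eq_zero_iff.mp this).symm
  · exfalso
    obtain ⟨v', hv', hd⟩ := exists_closer hT hvb
    have h3 := hT.dist_eq_dist_add_one_of_adj a hv'
    have h6 := hT.dist_eq_dist_add_one_of_adj v' hab
    have e1 := T.dist_comm (u := v) (v := b)
    have e2 := T.dist_comm (u := v') (v := b)
    have e3 := T.dist_comm (u := v) (v := a)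
    have e4 := T.dist_comm (u := v') (v := a)
    have e5 := T.dist_comm (u := u) (v := a)
    have hvu : v' = u := closer_unique hT hv' huv.symm (s := a) (by omega) (by omega)
    subst hvu
    omega

/-- identity on the `a`-side, `g` on the `b`-side. -/
theorem side_map {T : SimpleGraph V} {a b : V} {g : T ≃g T} (ha : g a = a) (hb : g b = b) (y : V) :
    g y ∈ EdgeSide T a b ↔ y ∈ EdgeSide T a b := by
  have h1 := iso_dist_eq T g a y
  have h2 := iso_dist_eq T g b y
  rw [ha] at h1
  rw [hb] at h2
  simp only [EdgeSide, Set.mem_ofPred_eq, h1, h2]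

open Classical in
noncomputable def cutFun (T : SimpleGraph V) (a b : V) (g : T ≃g T) (y : V) : V :=
  if y ∈ EdgeSide T a b then y else g y

theorem cutFun_adj {T : SimpleGraph V} (hT : T.IsTree) {a b : V} (hab : T.Adj a b) {g : T ≃g T}
    (ha : g a = a) (hb : g b = b) {u v : V} (h : T.Adj u v) :
    T.Adj (cutFun T a b g u) (cutFun T a b g v) := by
  have hg : T.Adj (g u) (g v) := g.map_adj_iff.mpr h
  unfold cutFun
  split_ifs with h1 h2 h2
  · exact h
  · obtain ⟨rfl, rfl⟩ := cross hT hab h1 ((side_or hT hab v).resolve_left h2) h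
    rwa [hb]
  · obtain ⟨rfl, rfl⟩ := cross hT hab h2 ((side_or hT hab u).resolve_left h1) h.symm
    rwa [hb]
  · exact hg

theorem cutFun_inv {T : SimpleGraph V} {a b : V} {g : T ≃g T}
    (ha : g a = a) (hb : g b = b) (y : V) : cutFun T a b g⁻¹ (cutFun T a b g y) = y := by
  have := side_map (T := T) ha hb y
  unfold cutFun
  by_cases h1 : y ∈ EdgeSide T a b
  · simp [h1]
  · simp [h1, this]

theorem inv_fix {T : SimpleGraph V} {a : V} {g : T ≃g T} (ha : g a = a) : g⁻¹ a = a := by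
  conv_lhs => rw [← ha]
  simp

noncomputable def cut {T : SimpleGraph V} (hT : T.IsTree) {a b : V} (hab : T.Adj a b) {g : T ≃g T}
    (ha : g a = a) (hb : g b = b) : T ≃g T where
  toFun := cutFun T a b g
  invFun := cutFun T a b g⁻¹
  left_inv := cutFun_inv ha hb
  right_inv := fun y => by
    have := cutFun_inv (T := T) (inv_fix ha) (inv_fix hb) y
    rwa [inv_inv] at this
  map_rel_iff' := by
    intro u v
    refine ⟨fun h => ?_, fun h => cutFun_adj hT hab ha hb h⟩
    have := cutFun_adj hT hab (inv_fix ha) (inv_fix hb) h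
    simpa only [Equiv.coe_fn_mk, cutFun_inv ha hb] using this

theorem cut_apply {T : SimpleGraph V} (hT : T.IsTree) {a b : V} (hab : T.Adj a b) {g : T ≃g T}
    (ha : g a = a) (hb : g b = b) (y : V) : cut hT hab ha hb y = cutFun T a b g y := rfl

theorem cut_of_mem {T : SimpleGraph V} (hT : T.IsTree) {a b : V} (hab : T.Adj a b) {g : T ≃g T}
    (ha : g a = a) (hb : g b = b) {y : V} (hy : y ∈ EdgeSide T a b) : cut hT hab ha hb y = y := by
  rw [cut_apply, cutFun, if_pos hy]

theorem cut_of_mem' {T : SimpleGraph V} (hT : T.IsTree) {a b : V} (hab : T.Adj a b) {g : T ≃g T}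
    (ha : g a = a) (hb : g b = b) {y : V} (hy : y ∈ EdgeSide T b a) :
    cut hT hab ha hb y = g y := by
  rw [cut_apply, cutFun, if_neg (fun h => not_both h hy)]

theorem mem_side_left {T : SimpleGraph V} {a b : V} (hab : T.Adj a b) : a ∈ EdgeSide T a b := by
  simp [EdgeSide, SimpleGraph.dist_eq_one_iff_adj, hab.symm]

theorem cut_left {T : SimpleGraph V} (hT : T.IsTree) {a b : V} (hab : T.Adj a b) {g : T ≃g T}
    (ha : g a = a) (hb : g b = b) : cut hT hab ha hb a = a :=
  cut_of_mem hT hab ha hb (mem_side_left hab)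

theorem cut_right {T : SimpleGraph V} (hT : T.IsTree) {a b : V} (hab : T.Adj a b) {g : T ≃g T}
    (ha : g a = a) (hb : g b = b) : cut hT hab ha hb b = b := by
  rw [cut_of_mem' hT hab ha hb (mem_side_left hab.symm), hb]

theorem cut_mul {T : SimpleGraph V} (hT : T.IsTree) {a b : V} (hab : T.Adj a b) {g : T ≃g T}
    (ha : g a = a) (hb : g b = b) : cut hT hab ha hb * cut hT hab.symm hb ha = g := by
  ext y
  change cut hT hab ha hb (cut hT hab.symm hb ha y) = g y
  rcases side_or hT hab y with h | h
  · rw [cut_of_mem' hT hab.symm hb ha h, cut_of_mem hT hab ha hb ((side_map ha hb y).mpr h)]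
  · rw [cut_of_mem hT hab.symm hb ha h, cut_of_mem' hT hab ha hb h]

/-! ### The universal group -/

theorem inUF_mul {d : ℕ} {T : SimpleGraph V} {F : Subgroup (Equiv.Perm (Fin d))}
    {ι : LegalColoring T d} {g h : T ≃g T} (hg : InUF T F ι g) (hh : InUF T F ι h) :
    InUF T F ι (g * h) := by
  intro x
  obtain ⟨τ, hτ, h1⟩ := hh x
  obtain ⟨σ, hσ, h2⟩ := hg (h x)
  refine ⟨σ * τ, F.mul_mem hσ hτ, fun y hy => ?_⟩
  rw [Equiv.Perm.mul_apply, h1 y hy, h2 (h y) (h.map_adj_iff.mpr hy)]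
  rfl

theorem inUF_one {d : ℕ} {T : SimpleGraph V} {F : Subgroup (Equiv.Perm (Fin d))}
    {ι : LegalColoring T d} : InUF T F ι 1 :=
  fun _ => ⟨1, F.one_mem, fun _ _ => rfl⟩

theorem inUF_inv {d : ℕ} {T : SimpleGraph V} {F : Subgroup (Equiv.Perm (Fin d))}
    {ι : LegalColoring T d} {g : T ≃g T} (hg : InUF T F ι g) : InUF T F ι g⁻¹ := by
  intro x
  obtain ⟨σ, hσ, h⟩ := hg (g⁻¹ x)
  refine ⟨σ⁻¹, F.inv_mem hσ, fun y hy => ?_⟩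
  rw [Equiv.Perm.inv_eq_iff_eq, h (g⁻¹ y) ((g⁻¹ : T ≃g T).map_adj_iff.mpr hy)]
  simp

theorem inUF_of_mem {d : ℕ} {T : SimpleGraph V} {F : Subgroup (Equiv.Perm (Fin d))}
    {ι : LegalColoring T d} {g : T ≃g T} (hg : g ∈ UFplus T F ι) : InUF T F ι g := by
  induction hg using Subgroup.closure_induction with
  | mem x hx => exact hx.1
  | one => exact inUF_one
  | mul x y _ _ hx hy => exact inUF_mul hx hy
  | inv x _ hx => exact inUF_inv hx

theorem cut_inUF {d : ℕ} {T : SimpleGraph V} {F : Subgroup (Equiv.Perm (Fin d))}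
    {ι : LegalColoring T d} (hT : T.IsTree) {a b : V} (hab : T.Adj a b) {g : T ≃g T}
    (ha : g a = a) (hb : g b = b) (hg : InUF T F ι g) : InUF T F ι (cut hT hab ha hb) := by
  intro x
  rcases side_or hT hab x with hx | hx
  · refine ⟨1, F.one_mem, fun y hy => ?_⟩
    rw [cut_of_mem hT hab ha hb hx]
    rcases side_or hT hab y with hy' | hy'
    · rw [cut_of_mem hT hab ha hb hy']; rfl
    · obtain ⟨rfl, rfl⟩ := cross hT hab hx hy' hy
      rw [cut_right]; rfl
  · obtain ⟨σ, hσ, h⟩ := hg x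
    refine ⟨σ, hσ, fun y hy => ?_⟩
    rw [cut_of_mem' hT hab ha hb hx, h y hy]
    rcases side_or hT hab y with hy' | hy'
    · obtain ⟨rfl, rfl⟩ := cross hT hab hy' hx hy.symm
      rw [cut_left, ha]
    · rw [cut_of_mem' hT hab ha hb hy']

theorem mem_of_fix {d : ℕ} {T : SimpleGraph V} {F : Subgroup (Equiv.Perm (Fin d))}
    {ι : LegalColoring T d} {g : T ≃g T} (hg : InUF T F ι g) {a b : V} (hab : T.Adj a b)
    (ha : g a = a) (hb : g b = b) : g ∈ UFplus T F ι :=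
  Subgroup.subset_closure ⟨hg, a, b, hab, ha, hb⟩

theorem titsIndep_UFplus {d : ℕ} {T : SimpleGraph V} {F : Subgroup (Equiv.Perm (Fin d))}
    {ι : LegalColoring T d} (hT : T.IsTree) : TitsIndep T (UFplus T F ι) := by
  intro a b hab g hg ha hb
  have hU := inUF_of_mem hg
  exact ⟨cut hT hab ha hb, mem_of_fix (cut_inUF hT hab ha hb hU) hab (cut_left ..) (cut_right ..),
    cut hT hab.symm hb ha, mem_of_fix (cut_inUF hT hab.symm hb ha hU) hab (cut_right ..)
      (cut_left ..), (cut_mul hT hab ha hb).symm, fun y hy => cut_of_mem hT hab ha hb hy,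
    fun y hy => cut_of_mem hT hab.symm hb ha hy⟩

/-! ### The ray -/

theorem eventually_side {T : SimpleGraph V} (hT : T.IsTree) (ξ : GeodRay T) (s : V) :
    ∃ N, ∀ n, N ≤ n → s ∈ EdgeSide T (ξ.seq n) (ξ.seq (n + 1)) := by
  have step : ∀ n, s ∈ EdgeSide T (ξ.seq n) (ξ.seq (n + 1)) →
      s ∈ EdgeSide T (ξ.seq (n + 1)) (ξ.seq (n + 1 + 1)) := by
    intro n hn
    refine (side_or hT (ξ.adj (n + 1)) s).resolve_right fun h => ?_
    have := closer_unique hT (ξ.adj n).symm (ξ.adj (n + 1)) hn h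
    have h2 := ξ.geodesic n (n + 2)
    rw [this] at h2
    simp [Nat.dist] at h2
  by_cases hex : ∃ N, s ∈ EdgeSide T (ξ.seq N) (ξ.seq (N + 1))
  · obtain ⟨N, hN⟩ := hex
    exact ⟨N, fun n hn => Nat.le_induction hN (fun m _ hm => step m hm) n hn⟩
  · exfalso
    push Not at hex
    have : ∀ n, T.dist (ξ.seq n) s + n = T.dist (ξ.seq 0) s := by
      intro n
      induction n with
      | zero => rfl
      | succ n ih =>
        have := (side_or hT (ξ.adj n) s).resolve_left (hex n)
        simp only [EdgeSide, Set.mem_ofPred_eq] at this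
        omega
    have := this (T.dist (ξ.seq 0) s + 1)
    omega

theorem fixes_subray {T : SimpleGraph V} (hT : T.IsTree) (ξ : GeodRay T) {g : T ≃g T}
    (hg : FixesEnd T g ξ) {x : V} (hx : g x = x) : ∃ n, ∀ m, n ≤ m → g (ξ.seq m) = ξ.seq m := by
  obtain ⟨k, l, h⟩ := hg
  have h' : ∀ j, T.dist x (ξ.seq (k + j)) = T.dist x (ξ.seq (l + j)) := by
    intro j
    have := iso_dist_eq T g x (ξ.seq (k + j))
    rw [hx] at this
    rw [← this, ← h j]
    rfl
  have key : ∀ (p t : ℕ), (∀ j, T.dist x (ξ.seq (p + j)) = T.dist x (ξ.seq (p + t + j))) →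
      t = 0 := by
    intro p t ht
    have hc : ∀ i, T.dist x (ξ.seq (p + i * t)) = T.dist x (ξ.seq p) := by
      intro i
      induction i with
      | zero => simp
      | succ i ih =>
        rw [← ih, ht (i * t)]
        congr 2
        ring
    by_contra h0
    set D := T.dist x (ξ.seq p)
    have h1 := ξ.geodesic p (p + (2 * D + 1) * t)
    have h2 := SimpleGraph.Connected.dist_triangle hT.connected (u := ξ.seq p) (v := x)
      (w := ξ.seq (p + (2 * D + 1) * t))
    rw [hc, T.dist_comm (u := ξ.seq p) (v := x), h1] at h2
    have h3 : 2 * D + 1 ≤ (2 * D + 1) * t := Nat.le_mul_of_pos_right _ (Nat.pos_of_ne_zero h0)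
    simp only [Nat.dist] at h2
    omega
  have hkl : k = l := by
    rcases le_total k l with hle | hle
    · obtain ⟨t, rfl⟩ := Nat.exists_eq_add_of_le hle
      have := key k t h'
      omega
    · obtain ⟨t, rfl⟩ := Nat.exists_eq_add_of_le hle
      have := key l t (fun j => (h' j).symm)
      omega
  subst hkl
  refine ⟨k, fun m hm => ?_⟩
  obtain ⟨j, rfl⟩ := Nat.exists_eq_add_of_le hm
  exact h j

/-- elements of `G` fixing the ray from `ξ n` on. -/
def KK (T : SimpleGraph V) (G : Subgroup (T ≃g T)) (ξ : GeodRay T) (n : ℕ) : Set G :=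
  {g : G | ∀ m, n ≤ m → (g : T ≃g T) (ξ.seq m) = ξ.seq m}

theorem KK_mono {T : SimpleGraph V} {G : Subgroup (T ≃g T)} {ξ : GeodRay T} {m n : ℕ}
    (h : m ≤ n) : KK T G ξ m ⊆ KK T G ξ n := fun _ hg k hk => hg k (h.trans hk)

theorem KK_sub {T : SimpleGraph V} {G : Subgroup (T ≃g T)} {ξ : GeodRay T} (n : ℕ) :
    KK T G ξ n ⊆ EndStab0 T G ξ := fun g hg =>
  ⟨⟨n, n, fun j => hg (n + j) (Nat.le_add_right _ _)⟩, _, hg n le_rfl⟩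

theorem exists_KK {T : SimpleGraph V} (hT : T.IsTree) {G : Subgroup (T ≃g T)} {ξ : GeodRay T}
    {g : G} (hg : g ∈ EndStab0 T G ξ) : ∃ n, g ∈ KK T G ξ n := by
  obtain ⟨h1, x, hx⟩ := hg
  exact fixes_subray hT ξ h1 hx

/-! ### Compactness -/

theorem sphere_finite {T : SimpleGraph V} (hT : T.IsTree) (hlf : LocFin T) (x : V) (r : ℕ) :
    {u : V | T.dist u x = r}.Finite := by
  induction r with
  | zero =>
    refine (Set.finite_singleton x).subset fun u hu => ?_
    exact hT.connected.dist_eq_zero_iff.mp hu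
  | succ r ih =>
    refine (ih.biUnion fun z _ => hlf z).subset fun u hu => ?_
    have hu' : T.dist u x = r + 1 := hu
    have hne : u ≠ x := by
      rintro rfl
      simp at hu'
    obtain ⟨y, hy, hd⟩ := exists_closer hT hne
    simp only [Set.mem_iUnion]
    exact ⟨y, show T.dist y x = r by omega, hy.symm⟩

theorem isInducing_eval [TopologicalSpace V] [hV : DiscreteTopology V] (T : SimpleGraph V) :
    IsInducing (fun (g : T ≃g T) (x : V) => g x) := by
  have := hV.eq_bot
  subst this
  let : TopologicalSpace V := ⊥
  exact ⟨rfl⟩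

theorem isClosed_two [TopologicalSpace V] [DiscreteTopology V] (x y : V) (P : V → V → Prop) :
    IsClosed {f : V → V | P (f x) (f y)} := by
  have hc : Continuous fun f : V → V => (f x, f y) := by fun_prop
  exact (isClosed_discrete {p : V × V | P p.1 p.2}).preimage hc

theorem isClosed_good [TopologicalSpace V] [DiscreteTopology V] {d : ℕ} (T : SimpleGraph V)
    (F : Subgroup (Equiv.Perm (Fin d))) (ι : LegalColoring T d) (ξ : GeodRay T) (n : ℕ)
    (B : V → Set V) (hB : ∀ v, (B v).Finite) :
    IsClosed {f : V → V | (∀ m, n ≤ m → f (ξ.seq m) = ξ.seq m) ∧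
      (∀ u v, T.Adj u v ↔ T.Adj (f u) (f v)) ∧ (∀ u v, f u = f v → u = v) ∧
      (∀ v, ∃ u ∈ B v, f u = v) ∧
      (∀ x, ∃ σ ∈ F, ∀ y, T.Adj x y → σ (ι.color x y) = ι.color (f x) (f y))} := by
  refine IsClosed.and ?_ (IsClosed.and ?_ (IsClosed.and ?_ (IsClosed.and ?_ ?_)))
  · simp only [Set.ofPred_forall]
    exact isClosed_iInter fun m => isClosed_iInter fun _ =>
      isClosed_two (ξ.seq m) (ξ.seq m) fun p _ => p = ξ.seq m
  · simp only [Set.ofPred_forall]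
    exact isClosed_iInter fun u => isClosed_iInter fun v =>
      isClosed_two u v fun p q => T.Adj u v ↔ T.Adj p q
  · simp only [Set.ofPred_forall]
    exact isClosed_iInter fun u => isClosed_iInter fun v =>
      isClosed_two u v fun p q => p = q → u = v
  · simp only [Set.ofPred_forall]
    refine isClosed_iInter fun v => ?_
    have : {f : V → V | ∃ u ∈ B v, f u = v} = ⋃ u ∈ B v, {f : V → V | f u = v} := by
      ext f; simp
    rw [this]
    exact (hB v).isClosed_biUnion fun u _ => isClosed_two u u fun p _ => p = v
  · simp only [Set.ofPred_forall]
    refine isClosed_iInter fun x => ?_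
    have : {f : V → V | ∃ σ ∈ F, ∀ y, T.Adj x y → σ (ι.color x y) = ι.color (f x) (f y)} =
        ⋃ σ ∈ (F : Set (Equiv.Perm (Fin d))), ⋂ y,
          {f : V → V | T.Adj x y → σ (ι.color x y) = ι.color (f x) (f y)} := by
      ext f; simp
    rw [this]
    exact (Set.toFinite _).isClosed_biUnion fun σ _ => isClosed_iInter fun y =>
      isClosed_two x y fun p q => T.Adj x y → σ (ι.color x y) = ι.color p q

theorem compact_KK {d : ℕ} {T : SimpleGraph V} (hT : T.IsTree) (hlf : LocFin T)
    (F : Subgroup (Equiv.Perm (Fin d))) (ι : LegalColoring T d) (ξ : GeodRay T) (n : ℕ) :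
    IsCompact {h : EndStab0 T (UFplus T F ι) ξ | (h : UFplus T F ι) ∈ KK T (UFplus T F ι) ξ n} := by
  let : TopologicalSpace V := ⊥
  have : DiscreteTopology V := ⟨rfl⟩
  have hi : IsInducing (fun (h : EndStab0 T (UFplus T F ι) ξ) (x : V) =>
      ((h : UFplus T F ι) : T ≃g T) x) :=
    (isInducing_eval T).comp (IsInducing.subtypeVal.comp IsInducing.subtypeVal)
  set B : V → Set V := fun v => {u | T.dist u (ξ.seq n) = T.dist v (ξ.seq n)} with hBdef
  have hB : ∀ v, (B v).Finite := fun v => sphere_finite hT hlf _ _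
  rw [hi.isCompact_iff]
  have hcomp : IsCompact (Set.univ.pi B) := isCompact_univ_pi fun v => (hB v).isCompact
  have := hcomp.inter_right (isClosed_good T F ι ξ n B hB)
  convert this using 1
  ext f
  constructor
  · rintro ⟨h, hh, rfl⟩
    have hfix : ((h : UFplus T F ι) : T ≃g T) (ξ.seq n) = ξ.seq n := hh n le_rfl
    have hU := inUF_of_mem (h : UFplus T F ι).2
    have hd : ∀ v, T.dist (((h : UFplus T F ι) : T ≃g T) v) (ξ.seq n) = T.dist v (ξ.seq n) := by
      intro v
      conv_lhs => rw [← hfix]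
      exact iso_dist_eq T _ _ _
    refine ⟨fun v _ => hd v, hh, fun u v => ((h : UFplus T F ι) : T ≃g T).map_adj_iff.symm,
      fun u v huv => ((h : UFplus T F ι) : T ≃g T).injective huv, fun v => ?_, hU⟩
    refine ⟨((h : UFplus T F ι) : T ≃g T).symm v, ?_, by simp⟩
    have := hd (((h : UFplus T F ι) : T ≃g T).symm v)
    rw [RelIso.apply_symm_apply] at this
    exact this.symm
  · rintro ⟨hfB, h1, h2, h3, h4, h5⟩
    have hsurj : Function.Surjective f := fun v => by
      obtain ⟨u, _, hu⟩ := h4 v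
      exact ⟨u, hu⟩
    let g : T ≃g T :=
      { toEquiv := Equiv.ofBijective f ⟨fun u v => h3 u v, hsurj⟩
        map_rel_iff' := fun {u v} => (h2 u v).symm }
    have hg : g ∈ UFplus T F ι := mem_of_fix h5 (ξ.adj n) (h1 n le_rfl) (h1 (n + 1) (Nat.le_succ n))
    have hK : (⟨g, hg⟩ : UFplus T F ι) ∈ KK T (UFplus T F ι) ξ n := h1
    exact ⟨⟨⟨g, hg⟩, KK_sub n hK⟩, hK, rfl⟩

theorem nhds_one {T : SimpleGraph V} (G : Subgroup (T ≃g T)) {U : Set G} (hU : U ∈ 𝓝 (1 : G)) :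
    ∃ S : Set V, S.Finite ∧ ∀ g : G, (∀ s ∈ S, (g : T ≃g T) s = s) → g ∈ U := by
  let : TopologicalSpace V := ⊥
  have : DiscreteTopology V := ⟨rfl⟩
  have hi : IsInducing (fun (h : G) (x : V) => (h : T ≃g T) x) :=
    (isInducing_eval T).comp IsInducing.subtypeVal
  rw [hi.nhds_eq_comap, Filter.mem_comap] at hU
  obtain ⟨W, hW, hWU⟩ := hU
  rw [nhds_pi, Filter.mem_pi] at hW
  obtain ⟨I, hI, t, ht, hIt⟩ := hW
  refine ⟨I, hI, fun g hg => hWU (hIt fun s hs => ?_)⟩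
  have := mem_of_mem_nhds (ht s)
  simp only [hg s hs]
  exact this

/-! ### Representation theory -/

/-- vectors invariant under a set -/
def inv {G : Type} [Group G] [TopologicalSpace G]
    {H : Type} [NormedAddCommGroup H] [InnerProductSpace ℂ H]
    (π : UnitaryRep G H) (A : Set G) : Submodule ℂ H where
  carrier := {v | ∀ g ∈ A, π.ρ g v = v}
  add_mem' := fun {v w} hv hw g hg => by rw [map_add, hv g hg, hw g hg]
  zero_mem' := fun g _ => map_zero _
  smul_mem' := fun c v hv g hg => by rw [map_smul, hv g hg]

section Rep

variable {G : Type} [Group G] [TopologicalSpace G]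
    {H : Type} [NormedAddCommGroup H] [InnerProductSpace ℂ H]

theorem mem_inv {π : UnitaryRep G H} {A : Set G} {v : H} :
    v ∈ inv π A ↔ ∀ g ∈ A, π.ρ g v = v := Iff.rfl

theorem inv_isClosed (π : UnitaryRep G H) (A : Set G) : IsClosed (inv π A : Set H) := by
  have : (inv π A : Set H) = ⋂ g ∈ A, {v | π.ρ g v = v} := by
    ext v; simp [mem_inv]
  rw [this]
  exact isClosed_biInter fun g _ => isClosed_eq (π.ρ g).continuous continuous_id

instance inv_complete [CompleteSpace H] (π : UnitaryRep G H) (A : Set G) :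
    CompleteSpace (inv π A) := (inv_isClosed π A).completeSpace_coe

theorem rho_mul (π : UnitaryRep G H) (g h : G) (v : H) : π.ρ (g * h) v = π.ρ g (π.ρ h v) := by
  rw [map_mul]; rfl

theorem exists_near_inv [CompleteSpace H] (π : UnitaryRep G H) (U : Subgroup G) (v : H) (ε : ℝ)
    (h : ∀ g ∈ U, ‖π.ρ g v - v‖ ≤ ε) : ∃ u ∈ inv π (U : Set G), ‖u - v‖ ≤ ε := by
  let : InnerProductSpace ℝ H := InnerProductSpace.rclikeToReal ℂ H
  set O : Set H := {x | ∃ g ∈ U, x = π.ρ g v} with hO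
  set C : Set H := closure (convexHull ℝ O) with hC
  have hCc : Convex ℝ C := (convex_convexHull ℝ O).closure
  have hvC : v ∈ C := subset_closure (subset_convexHull ℝ O ⟨1, U.one_mem, by simp⟩)
  have hball : C ⊆ Metric.closedBall v ε := by
    refine closure_minimal (convexHull_min ?_ (convex_closedBall v ε)) Metric.isClosed_closedBall
    rintro x ⟨g, hg, rfl⟩
    rw [mem_closedBall_iff_norm]
    exact h g hg
  have hinv : ∀ g ∈ U, ∀ x ∈ C, π.ρ g x ∈ C := by
    intro g hg
    have hcl : IsClosed {x | π.ρ g x ∈ C} := isClosed_closure.preimage (π.ρ g).continuous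
    have hcv : Convex ℝ {x | π.ρ g x ∈ C} := by
      intro x hx y hy a b ha hb hab
      have e : ∀ (r : ℝ) (z : H), π.ρ g (r • z) = r • π.ρ g z := fun r z =>
        map_smul (π.ρ g) (r : ℂ) z
      change π.ρ g (a • x + b • y) ∈ C
      rw [map_add, e, e]
      exact hCc hx hy ha hb hab
    refine closure_minimal (convexHull_min ?_ hcv) hcl
    rintro x ⟨k, hk, rfl⟩
    refine subset_closure (subset_convexHull ℝ O ⟨g * k, U.mul_mem hg hk, ?_⟩)
    rw [rho_mul]
  obtain ⟨u, huC, hu⟩ := exists_norm_eq_iInf_of_complete_convex ⟨v, hvC⟩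
    isClosed_closure.isComplete hCc (0 : H)
  refine ⟨u, fun g hg => ?_, mem_closedBall_iff_norm.mp (hball huC)⟩
  have hgu := hinv g hg u huC
  have hu' : ‖(0 : H) - π.ρ g u‖ = ⨅ w : C, ‖(0 : H) - w‖ := by
    rw [← hu]; simp
  have h1 := (norm_eq_iInf_iff_real_inner_le_zero hCc huC).mp hu _ hgu
  have h2 := (norm_eq_iInf_iff_real_inner_le_zero hCc hgu).mp hu' _ huC
  generalize π.ρ g u = w at *
  have h3 : inner ℝ (w - u) (w - u) ≤ (0 : ℝ) := by
    simp only [zero_sub, inner_neg_left, inner_sub_right, inner_sub_left] at *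
    linarith
  have h4 := real_inner_self_nonpos.mp h3
  exact sub_eq_zero.mp h4

theorem inv_conj {π : UnitaryRep G H} {B : Set G} {a : G} (ha : ∀ b ∈ B, a⁻¹ * b * a ∈ B) {v : H}
    (hv : v ∈ inv π B) : π.ρ a v ∈ inv π B := by
  intro b hb
  rw [← rho_mul]
  have : b * a = a * (a⁻¹ * b * a) := by group
  rw [this, rho_mul, hv _ (ha b hb)]

theorem rho_inv_apply (π : UnitaryRep G H) (a : G) (v : H) : π.ρ a (π.ρ a⁻¹ v) = v := by
  rw [← rho_mul]; simp

theorem proj_fixed [CompleteSpace H] {π : UnitaryRep G H} {B : Set G} {a : G}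
    (ha : ∀ b ∈ B, a⁻¹ * b * a ∈ B) (ha' : ∀ b ∈ B, a * b * a⁻¹ ∈ B) {w : H}
    (hw : π.ρ a w = w) : π.ρ a ((inv π B).starProjection w) = (inv π B).starProjection w := by
  symm
  apply Submodule.eq_starProjection_of_mem_of_inner_eq_zero
  · exact inv_conj ha (Submodule.starProjection_apply_mem _ _)
  · intro e he
    have h1 : w - π.ρ a ((inv π B).starProjection w) =
        π.ρ a (w - (inv π B).starProjection w) := by rw [map_sub, hw]
    rw [h1, ← rho_inv_apply π a e, LinearIsometryEquiv.inner_map_map]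
    apply Submodule.starProjection_inner_eq_zero
    exact inv_conj (by simpa using ha') he

theorem inner_bound [CompleteSpace H] {E W : Submodule ℂ H} [E.HasOrthogonalProjection]
    [W.HasOrthogonalProjection] {x w : H} (hx : x ∈ E) (hw : E.starProjection w ∈ W) :
    ‖⟪x, w⟫_ℂ‖ ≤ ‖x‖ * ‖W.starProjection w‖ := by
  have h1 : ⟪x, w⟫_ℂ = ⟪x, E.starProjection w⟫_ℂ := by
    rw [← Submodule.inner_starProjection_left_eq_right,
      Submodule.starProjection_eq_self_iff.mpr hx]
  have h2 : ‖E.starProjection w‖ ≤ ‖W.starProjection w‖ := by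
    have h3 : ⟪E.starProjection w, E.starProjection w⟫_ℂ =
        ⟪E.starProjection w, W.starProjection w⟫_ℂ := by
      rw [← Submodule.inner_starProjection_left_eq_right,
        ← Submodule.inner_starProjection_left_eq_right,
        Submodule.starProjection_eq_self_iff.mpr hw,
        Submodule.starProjection_eq_self_iff.mpr (Submodule.starProjection_apply_mem _ _)]
    have h4 := norm_inner_le_norm (𝕜 := ℂ) (E.starProjection w) (W.starProjection w)
    rw [← h3, inner_self_eq_norm_sq_to_K] at h4
    simp only [norm_pow, RCLike.norm_ofReal, abs_norm] at h4
    rcases (norm_nonneg (E.starProjection w)).eq_or_lt with h0 | h0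
    · rw [← h0]; exact norm_nonneg _
    · nlinarith
  rw [h1]
  exact (norm_inner_le_norm _ _).trans (mul_le_mul_of_nonneg_left h2 (norm_nonneg _))

theorem proj_tendsto_zero [CompleteSpace H] (W : ℕ → Submodule ℂ H)
    [∀ n, CompleteSpace (W n)] (hW : Antitone W) (h0 : ∀ v, (∀ n, v ∈ W n) → v = 0) (w : H) :
    Tendsto (fun n => (W n).starProjection w) atTop (𝓝 0) := by
  have hmono : Monotone fun n => (W n)ᗮ := fun m n hmn => Submodule.orthogonal_le (hW hmn)
  have htop : ⊤ ≤ (⨆ n, (W n)ᗮ).topologicalClosure := by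
    rw [top_le_iff, Submodule.topologicalClosure_eq_top_iff, ← Submodule.iInf_orthogonal,
      Submodule.eq_bot_iff]
    intro x hx
    refine h0 x fun n => ?_
    have := (Submodule.mem_iInf _).mp hx n
    rwa [Submodule.orthogonal_orthogonal] at this
  have h1 := Submodule.starProjection_tendsto_self (fun n => (W n)ᗮ) hmono w htop
  have h2 := h1.const_sub w
  simpa [Submodule.starProjection_orthogonal] using h2

end Rep

/-- pointwise stabilizer of a set -/
def fixS {T : SimpleGraph V} (G : Subgroup (T ≃g T)) (S : Set V) : Subgroup G where
  carrier := {g | ∀ s ∈ S, (g : T ≃g T) s = s}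
  one_mem' := fun _ _ => rfl
  mul_mem' := fun {g h} hg hh s hs => by
    change (g : T ≃g T) ((h : T ≃g T) s) = s
    rw [hh s hs, hg s hs]
  inv_mem' := fun {g} hg s hs => inv_fix (hg s hs)

theorem exists_smooth {T : SimpleGraph V} {G : Subgroup (T ≃g T)}
    {H : Type} [NormedAddCommGroup H] [InnerProductSpace ℂ H] [CompleteSpace H]
    (π : UnitaryRep G H) (v : H) {ε : ℝ} (hε : 0 < ε) :
    ∃ S : Set V, S.Finite ∧ ∃ u ∈ inv π (fixS G S : Set G), ‖u - v‖ ≤ ε := by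
  have hc := (π.strong_continuity v).continuousAt (x := 1)
  have hU := hc (Metric.closedBall_mem_nhds _ hε)
  obtain ⟨S, hS, hSU⟩ := nhds_one G hU
  refine ⟨S, hS, exists_near_inv π (fixS G S) v ε fun g hg => ?_⟩
  have := hSU g hg
  simpa [mem_closedBall_iff_norm, ← dist_eq_norm] using this

theorem eventually_side_finite {T : SimpleGraph V} (hT : T.IsTree) (ξ : GeodRay T) {S : Set V}
    (hS : S.Finite) : ∃ N, ∀ n, N ≤ n → ∀ s ∈ S, s ∈ EdgeSide T (ξ.seq n) (ξ.seq (n + 1)) := by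
  choose N hN using eventually_side hT ξ
  obtain ⟨M, hM⟩ := (hS.image N).bddAbove
  exact ⟨M, fun n hn s hs => hN s n ((hM ⟨s, hs, rfl⟩).trans hn)⟩

theorem main_bound {T : SimpleGraph V} (hT : T.IsTree) {G : Subgroup (T ≃g T)}
    (hG : TitsIndep T G) (ξ : GeodRay T)
    {H : Type} [NormedAddCommGroup H] [InnerProductSpace ℂ H] [CompleteSpace H]
    (π : UnitaryRep G H) {S S' : Set V} {v w : H} (hv : v ∈ inv π (fixS G S : Set G))
    (hw : w ∈ inv π (fixS G S' : Set G)) {n : ℕ}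
    (hS : ∀ s ∈ S, s ∈ EdgeSide T (ξ.seq n) (ξ.seq (n + 1)))
    (hS' : ∀ s ∈ S', s ∈ EdgeSide T (ξ.seq n) (ξ.seq (n + 1)))
    {h : G} (h1 : (h : T ≃g T) (ξ.seq (n + 1)) = ξ.seq (n + 1))
    (h2 : (h : T ≃g T) (ξ.seq n) ≠ ξ.seq n) :
    ‖⟪π.ρ h v, w⟫_ℂ‖ ≤ ‖v‖ * ‖(inv π (KK T G ξ n)).starProjection w‖ := by
  set a := ξ.seq n with ha
  set b := ξ.seq (n + 1) with hb
  have hab : T.Adj a b := ξ.adj n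
  set B : Set G := (fixS G (EdgeSide T b a) : Set G) with hB
  have hx : π.ρ h v ∈ inv π B := by
    intro g hg
    have e : g * h = h * (h⁻¹ * g * h) := by group
    rw [← rho_mul, e, rho_mul, hv]
    intro s hs
    change (h : T ≃g T)⁻¹ ((g : T ≃g T) ((h : T ≃g T) s)) = s
    have hmem : (h : T ≃g T) s ∈ EdgeSide T b a := by
      refine (side_or hT hab _).resolve_left fun hh => h2 ?_
      have hs' := hS s hs
      have e1 := iso_dist_eq T (h : T ≃g T) a s
      have e2 := iso_dist_eq T (h : T ≃g T) b s
      rw [h1] at e2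
      refine closer_unique hT (x := b) (s := (h : T ≃g T) s) ?_ hab.symm ?_ hh
      · rw [← h1]
        exact (h : T ≃g T).map_adj_iff.mpr hab.symm
      · rw [e1, e2]; exact hs'
    rw [hg _ hmem]
    simp
  have hnorm : ∀ c : G, (c : T ≃g T) a = a → (c : T ≃g T) b = b → ∀ g ∈ B, c⁻¹ * g * c ∈ B := by
    intro c hca hcb g hg s hs
    change (c : T ≃g T)⁻¹ ((g : T ≃g T) ((c : T ≃g T) s)) = s
    rw [hg _ ((side_map hcb hca s).mpr hs)]
    simp
  have hP : (inv π B).starProjection w ∈ inv π (KK T G ξ n) := by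
    intro g hg
    have hga : (g : T ≃g T) a = a := hg n le_rfl
    have hgb : (g : T ≃g T) b = b := hg (n + 1) (Nat.le_succ n)
    obtain ⟨g₁, hg₁, g₂, hg₂, e, hf₁, hf₂⟩ := hG a b hab g g.2 hga hgb
    have e' : g = (⟨g₁, hg₁⟩ : G) * ⟨g₂, hg₂⟩ := Subtype.ext e
    have h2b : g₂ b = b := hf₂ b (mem_side_left hab.symm)
    have h1a : g₁ a = a := hf₁ a (mem_side_left hab)
    have h1b : g₁ b = b := by
      have : g₁ (g₂ b) = b := by
        have := hgb
        rw [e] at this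
        exact this
      rwa [h2b] at this
    rw [e', rho_mul]
    have s2 : π.ρ ⟨g₂, hg₂⟩ ((inv π B).starProjection w) = (inv π B).starProjection w :=
      Submodule.starProjection_apply_mem (inv π B) w ⟨g₂, hg₂⟩ hf₂
    rw [s2]
    refine proj_fixed (hnorm ⟨g₁, hg₁⟩ h1a h1b) ?_ ?_
    · have := hnorm (⟨g₁, hg₁⟩ : G)⁻¹ (inv_fix h1a) (inv_fix h1b)
      simpa only [inv_inv] using this
    · exact hw ⟨g₁, hg₁⟩ fun s hs => hf₁ s (hS' s hs)
  have := inner_bound hx hP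
  rwa [LinearIsometryEquiv.norm_map] at this

theorem tendsto_smooth {T : SimpleGraph V} (hT : T.IsTree) {G : Subgroup (T ≃g T)}
    (hG : TitsIndep T G) (ξ : GeodRay T)
    (hK : ∀ n, IsCompact {h : EndStab0 T G ξ | (h : G) ∈ KK T G ξ n})
    {H : Type} [NormedAddCommGroup H] [InnerProductSpace ℂ H] [CompleteSpace H]
    (π : UnitaryRep G H) (hno : ∀ v : H, (∀ g ∈ EndStab0 T G ξ, π.ρ g v = v) → v = 0)
    {S S' : Set V} (fS : S.Finite) (fS' : S'.Finite)
    {v w : H} (hv : v ∈ inv π (fixS G S : Set G))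
    (hw : w ∈ inv π (fixS G S' : Set G)) :
    Tendsto (fun h : EndStab0 T G ξ => ⟪π.ρ (h : G) v, w⟫_ℂ) (cocompact _) (𝓝 0) := by
  have hanti : Antitone fun n => inv π (KK T G ξ n) :=
    fun m n hmn x hx g hg => hx g (KK_mono hmn hg)
  have hlim := proj_tendsto_zero (fun n => inv π (KK T G ξ n)) hanti (fun x hx => hno x
    fun g hg => by
      obtain ⟨n, hn⟩ := exists_KK hT hg
      exact hx n g hn) w
  have hlim2 : Tendsto (fun n => ‖v‖ * ‖(inv π (KK T G ξ n)).starProjection w‖) atTop (𝓝 0) := by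
    simpa using hlim.norm.const_mul ‖v‖
  obtain ⟨N₁, hN₁⟩ := eventually_side_finite hT ξ fS
  obtain ⟨N₂, hN₂⟩ := eventually_side_finite hT ξ fS'
  rw [Metric.tendsto_nhds]
  intro ε hε
  obtain ⟨N₃, hN₃⟩ := eventually_atTop.mp ((tendsto_order.mp hlim2).2 ε hε)
  set N := max N₁ (max N₂ N₃)
  filter_upwards [(hK N).compl_mem_cocompact] with h hh
  have hex := exists_KK hT h.2
  classical
  have hspec := Nat.find_spec hex
  have hmin := fun m hm => Nat.find_min hex (m := m) hm
  have hlt : N < Nat.find hex := by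
    by_contra hle
    exact hh (KK_mono (not_lt.mp hle) hspec)
  generalize Nat.find hex = k at *
  obtain ⟨n, rfl⟩ : ∃ n, k = n + 1 := ⟨k - 1, by omega⟩
  have hnN : N ≤ n := by omega
  have h1 := hspec (n + 1) le_rfl
  have h2 : ((h : G) : T ≃g T) (ξ.seq n) ≠ ξ.seq n := fun hfix => by
    refine hmin n (Nat.lt_succ_self n) fun m hm => ?_
    rcases hm.eq_or_lt with rfl | hm
    · exact hfix
    · exact hspec m hm
  have hb := main_bound hT hG ξ π hv hw (hN₁ n (by omega)) (hN₂ n (by omega)) h1 h2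
  rw [dist_zero_right]
  exact hb.trans_lt (hN₃ n (by omega))

/-- Let `d ≥ 3` and `F` be primitive but not cyclic of prime order.  Then
for every end `ξ ∈ ∂𝒯` the pair `(U(F)⁺, (U(F)⁺)_ξ⁰)` has the relative Howe–Moore
property:  every unitary representation of `U(F)⁺` either has a nonzero
`(U(F)⁺)_ξ⁰`-invariant vector, or its restriction to `(U(F)⁺)_ξ⁰` has all matrix
coefficients vanishing at infinity in `(U(F)⁺)_ξ⁰`. -/
theorem relative_howeMoore_end_stabilizer
    {V : Type} (T : SimpleGraph V) (d : ℕ) (hd : 3 ≤ d)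
    (hT : T.IsTree) (hreg : Regular T d) (ι : LegalColoring T d)
    (F : Subgroup (Equiv.Perm (Fin d)))
    (hprim : PermPrimitive F) (hncyc : ¬ CyclicOfPrimeOrder F)
    (ξ : GeodRay T)
    (H : Type) [NormedAddCommGroup H] [InnerProductSpace ℂ H] [CompleteSpace H]
    (π : UnitaryRep (UFplus T F ι) H) :
    (∃ v : H, v ≠ 0 ∧ ∀ g ∈ EndStab0 T (UFplus T F ι) ξ, π.ρ g v = v) ∨
      (∀ v w : H,
        Tendsto (fun h : EndStab0 T (UFplus T F ι) ξ => ⟪π.ρ (h : UFplus T F ι) v, w⟫_ℂ)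
          (cocompact (EndStab0 T (UFplus T F ι) ξ)) (𝓝 0)) := by
  by_cases hex : ∃ v : H, v ≠ 0 ∧ ∀ g ∈ EndStab0 T (UFplus T F ι) ξ, π.ρ g v = v
  · exact Or.inl hex
  right
  have hno : ∀ v : H, (∀ g ∈ EndStab0 T (UFplus T F ι) ξ, π.ρ g v = v) → v = 0 := by
    intro v hv
    by_contra h0
    exact hex ⟨v, h0, hv⟩
  have hlf : LocFin T := fun x => Set.finite_of_ncard_pos (by rw [hreg x]; omega)
  have hK := compact_KK hT hlf F ι ξ
  intro v w
  rw [Metric.tendsto_nhds]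
  intro ε hε
  obtain ⟨S, fS, v', hv', hvv⟩ := exists_smooth π v
    (show 0 < ε / (4 * (‖w‖ + 1)) by positivity)
  obtain ⟨S', fS', w', hw', hww⟩ := exists_smooth π w
    (show 0 < ε / (4 * (‖v'‖ + 1)) by positivity)
  have ht := tendsto_smooth hT (titsIndep_UFplus hT) ξ hK π hno fS fS' hv' hw'
  rw [Metric.tendsto_nhds] at ht
  filter_upwards [ht (ε / 4) (by positivity)] with h hh
  rw [dist_zero_right] at hh ⊢
  obtain ⟨g, hg⟩ := h
  change ‖⟪π.ρ g v, w⟫_ℂ‖ < ε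
  change ‖⟪π.ρ g v', w'⟫_ℂ‖ < ε / 4 at hh
  have e : ⟪π.ρ g v, w⟫_ℂ = ⟪π.ρ g v', w'⟫_ℂ - ⟪π.ρ g v', w' - w⟫_ℂ - ⟪π.ρ g (v' - v), w⟫_ℂ := by
    rw [map_sub, inner_sub_left, inner_sub_right]
    ring
  have b1 : ‖⟪π.ρ g v', w' - w⟫_ℂ‖ ≤ ε / 4 := by
    refine (norm_inner_le_norm _ _).trans ?_
    rw [LinearIsometryEquiv.norm_map]
    rw [le_div_iff₀ (by positivity)] at hww
    nlinarith [norm_nonneg v', norm_nonneg (w' - w)]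
  have b2 : ‖⟪π.ρ g (v' - v), w⟫_ℂ‖ ≤ ε / 4 := by
    refine (norm_inner_le_norm _ _).trans ?_
    rw [LinearIsometryEquiv.norm_map]
    rw [le_div_iff₀ (by positivity)] at hvv
    nlinarith [norm_nonneg w, norm_nonneg (v' - v)]
  rw [e]
  have b3 := norm_sub_le (⟪π.ρ g v', w'⟫_ℂ - ⟪π.ρ g v', w' - w⟫_ℂ) ⟪π.ρ g (v' - v), w⟫_ℂ
  have b4 := norm_sub_le ⟪π.ρ g v', w'⟫_ℂ ⟪π.ρ g v', w' - w⟫_ℂ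
  linarith

end TreeHM
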